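/- There do not exist positive integers d_A, d_B, self-adjoint unitary matrices A₁, A₂, A₃ ∈ M_{d_A}(ℂ) and B₁, B₂, B₃ ∈ M_{d_B}(ℂ), and an isometry V : ℂ³ → ℂ^{d_A} ⊗ ℂ^{d_B} such that V*(A₂ ⊗ B₂)V = [[0,0,1/√2],[0,0,1/√2],[1/√2,1/√2,0]], V*(A₃ ⊗ B₃)V = [[0,0,1],[0,1,0],[1,0,0]], and V*(A₁ ⊗ I)V = V*(I ⊗ B₁)V = diag(1,−1,−1). (This is the finite-dimensional nonexistence part of Theorem 2.1 of the paper, showing that the explicitly constructed correlation in C_qs^{(3)}(3,2) does not lie in C_q^{(3)}(3,2).) -/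

import Mathlib

open Matrix Kronecker

/-- `1/√2` as a complex number. -/
noncomputable def invSqrt2 : ℂ := 1 / (Real.sqrt 2 : ℂ)

open scoped ComplexOrder in
/-- If `M` is a Hermitian unitary whose compression `N = Vᴴ M V` to the range of an isometry `V`
preserves inner products of the columns of `C`, then `M` intertwines: `M V C = V N C`. -/
theorem mul_mul_eq_of_compression {m n k : Type*} [Fintype m] [DecidableEq m] [Fintype n]
    [DecidableEq n] [Fintype k] {M : Matrix m m ℂ} {V : Matrix m n ℂ} {N : Matrix n n ℂ}
    (hM : Mᴴ = M) (hMM : M * M = 1) (hV : Vᴴ * V = 1) (hN : Vᴴ * M * V = N)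
    (C : Matrix n k ℂ) (hC : N * N * C = C) : M * V * C = V * N * C := by
  have hNh : Nᴴ = N := by
    rw [← hN]
    simp [Matrix.conjTranspose_mul, hM, Matrix.mul_assoc]
  have key : (M * V - V * N)ᴴ * (M * V - V * N) = 1 - N * N := by
    have h1 : Vᴴ * M * (M * V) = 1 := by
      rw [Matrix.mul_assoc, ← Matrix.mul_assoc M, hMM, Matrix.one_mul, hV]
    have h2 : Vᴴ * M * (V * N) = N * N := by rw [← Matrix.mul_assoc, hN]
    have h3 : N * Vᴴ * (M * V) = N * N := by
      rw [Matrix.mul_assoc, ← Matrix.mul_assoc Vᴴ, hN]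
    have h4 : N * Vᴴ * (V * N) = N * N := by
      rw [Matrix.mul_assoc, ← Matrix.mul_assoc Vᴴ, hV, Matrix.one_mul]
    rw [Matrix.conjTranspose_sub, Matrix.conjTranspose_mul, Matrix.conjTranspose_mul, hM, hNh,
      Matrix.sub_mul, Matrix.mul_sub, Matrix.mul_sub, h1, h2, h3, h4]
    abel
  have hE : (M * V - V * N) * C = 0 := by
    rw [← Matrix.conjTranspose_mul_self_eq_zero, Matrix.conjTranspose_mul, Matrix.mul_assoc,
      ← Matrix.mul_assoc _ _ C, key, Matrix.sub_mul, Matrix.one_mul, hC, sub_self,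
      Matrix.mul_zero]
  rwa [Matrix.sub_mul, sub_eq_zero] at hE

/-- The `j`-th column of `V`, a vector of a tensor product, as a matrix of coefficients. -/
def coeffMatrix {l m n : Type*} (V : Matrix (l × m) n ℂ) (j : n) : Matrix l m ℂ :=
  Matrix.of fun a b => V (a, b) j

theorem coeffMatrix_kronecker_mul {l m n : Type*} [Fintype l] [Fintype m]
    (A : Matrix l l ℂ) (B : Matrix m m ℂ) (V : Matrix (l × m) n ℂ) (j : n) :
    coeffMatrix ((A ⊗ₖ B) * V) j = A * coeffMatrix V j * Bᵀ := by
  ext a b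
  simp only [coeffMatrix, Matrix.of_apply, Matrix.mul_apply, Matrix.kroneckerMap_apply,
    Matrix.transpose_apply, Fintype.sum_prod_type, Finset.sum_mul]
  rw [Finset.sum_comm]
  exact Finset.sum_congr rfl fun _ _ => Finset.sum_congr rfl fun _ _ => by ring

theorem conjTranspose_kronecker_self {l m : Type*} {A : Matrix l l ℂ} {B : Matrix m m ℂ}
    (hA : Aᴴ = A) (hB : Bᴴ = B) : (A ⊗ₖ B)ᴴ = A ⊗ₖ B := by
  rw [Matrix.conjTranspose_kronecker, hA, hB]

theorem kronecker_mul_self_eq_one {l m : Type*} [Fintype l] [Fintype m] [DecidableEq l]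
    [DecidableEq m] {A : Matrix l l ℂ} {B : Matrix m m ℂ}
    (hA : A * A = 1) (hB : B * B = 1) : (A ⊗ₖ B) * (A ⊗ₖ B) = 1 := by
  rw [← Matrix.mul_kronecker_mul, hA, hB, Matrix.one_kronecker_one]

theorem rank_mul_mul_transpose_of_involutive {l m : Type*} [Fintype l] [Fintype m] [DecidableEq l]
    [DecidableEq m] {A : Matrix l l ℂ} {B : Matrix m m ℂ}
    (hA : A * A = 1) (hB : B * B = 1) (X : Matrix l m ℂ) : (A * X * Bᵀ).rank = X.rank := by
  have hB' : Bᵀ * Bᵀ = 1 := by rw [← Matrix.transpose_mul, hB, Matrix.transpose_one]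
  rw [Matrix.rank_mul_eq_left_of_isUnit_det _ _
      ((Matrix.isUnit_iff_isUnit_det _).1 (IsUnit.of_mul_eq_one _ hB')),
    Matrix.rank_mul_eq_right_of_isUnit_det _ _
      ((Matrix.isUnit_iff_isUnit_det _).1 (IsUnit.of_mul_eq_one _ hA))]

/-- If `X` and `Y` lie in opposite eigenspaces of `A` on the left and of `B` on the right, and
adding `Y` to `X` does not change the rank, then `Y = 0`. -/
theorem eq_zero_of_rank_add_eq {l m : Type*} [Fintype l] [Fintype m] [DecidableEq m]
    {A : Matrix l l ℂ} {B : Matrix m m ℂ} {X Y : Matrix l m ℂ}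
    (hAX : A * X = X) (hAY : A * Y = -Y) (hXB : X * B = X) (hYB : Y * B = -Y)
    (hr : (X + Y).rank = X.rank) : Y = 0 := by
  have hX : X = (X + Y) * ((1 / 2 : ℂ) • (1 + B)) := by
    rw [Matrix.mul_smul, Matrix.mul_add, Matrix.mul_one, Matrix.add_mul, hXB, hYB]
    module
  have hle : LinearMap.range X.mulVecLin ≤ LinearMap.range (X + Y).mulVecLin := by
    conv_lhs => rw [hX, Matrix.mulVecLin_mul]
    exact LinearMap.range_comp_le_range _ _
  have heq := Submodule.eq_of_le_of_finrank_eq hle hr.symm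
  refine Matrix.ext_of_mulVec_single fun i => ?_
  have hfix : ∀ w, A *ᵥ ((X + Y) *ᵥ w) = (X + Y) *ᵥ w := fun w => by
    obtain ⟨u, hu⟩ : (X + Y).mulVecLin w ∈ LinearMap.range X.mulVecLin := by
      rw [heq]; exact ⟨w, rfl⟩
    simp only [Matrix.mulVecLin_apply] at hu
    rw [← hu, Matrix.mulVec_mulVec, hAX]
  have h := hfix (Pi.single i 1)
  rw [Matrix.mulVec_mulVec, Matrix.mul_add, hAX, hAY, Matrix.add_mulVec, Matrix.add_mulVec,
    add_right_inj, Matrix.neg_mulVec] at h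
  rw [Matrix.zero_mulVec]
  exact self_eq_neg.1 h.symm

theorem invSqrt2_mul_self : invSqrt2 * invSqrt2 = 1 / 2 := by
  have h : ((Real.sqrt 2 : ℝ) : ℂ) * (Real.sqrt 2 : ℝ) = 2 := by
    rw [← Complex.ofReal_mul, Real.mul_self_sqrt (by norm_num)]
    norm_num
  rw [invSqrt2, div_mul_div_comm, h, one_mul]

/-- The finite-dimensional nonexistence part of Theorem 2.1: no finite-dimensional
tensor-product model (self-adjoint unitaries `A₁,A₂,A₃`, `B₁,B₂,B₃` and an isometry
`V : ℂ³ → ℂ^{d_A} ⊗ ℂ^{d_B}`) realizes the matrix correlations (9)–(11). -/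
theorem stmt5 :
    ¬ ∃ (dA dB : ℕ) (_ : 0 < dA) (_ : 0 < dB)
        (A₁ A₂ A₃ : Matrix (Fin dA) (Fin dA) ℂ)
        (B₁ B₂ B₃ : Matrix (Fin dB) (Fin dB) ℂ)
        (V : Matrix (Fin dA × Fin dB) (Fin 3) ℂ),
      (A₁ᴴ = A₁ ∧ A₁ * A₁ = 1) ∧ (A₂ᴴ = A₂ ∧ A₂ * A₂ = 1) ∧
      (A₃ᴴ = A₃ ∧ A₃ * A₃ = 1) ∧
      (B₁ᴴ = B₁ ∧ B₁ * B₁ = 1) ∧ (B₂ᴴ = B₂ ∧ B₂ * B₂ = 1) ∧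
      (B₃ᴴ = B₃ ∧ B₃ * B₃ = 1) ∧
      Vᴴ * V = 1 ∧
      Vᴴ * (A₂ ⊗ₖ B₂) * V =
        !![0, 0, invSqrt2; 0, 0, invSqrt2; invSqrt2, invSqrt2, 0] ∧
      Vᴴ * (A₃ ⊗ₖ B₃) * V = !![0, 0, 1; 0, 1, 0; 1, 0, 0] ∧
      Vᴴ * (A₁ ⊗ₖ (1 : Matrix (Fin dB) (Fin dB) ℂ)) * V =
        !![1, 0, 0; 0, -1, 0; 0, 0, -1] ∧
      Vᴴ * ((1 : Matrix (Fin dA) (Fin dA) ℂ) ⊗ₖ B₁) * V =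
        !![1, 0, 0; 0, -1, 0; 0, 0, -1] := by
  rintro ⟨dA, dB, -, -, A₁, A₂, A₃, B₁, B₂, B₃, V, ⟨hA₁, hA₁'⟩, ⟨hA₂, hA₂'⟩, ⟨hA₃, hA₃'⟩,
    ⟨hB₁, hB₁'⟩, ⟨hB₂, hB₂'⟩, ⟨hB₃, hB₃'⟩, hV, h₂, h₃, hA, hB⟩
  have hs := invSqrt2_mul_self
  have hs0 : invSqrt2 ≠ 0 := by
    intro h
    simp [h] at hs
  have e₃ := mul_mul_eq_of_compression (conjTranspose_kronecker_self hA₃ hB₃)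
    (kronecker_mul_self_eq_one hA₃' hB₃') hV h₃ (1 : Matrix (Fin 3) (Fin 3) ℂ) (by
      ext i j
      fin_cases i <;> fin_cases j <;> simp [Matrix.mul_apply, Fin.sum_univ_three])
  have eA := mul_mul_eq_of_compression
    (conjTranspose_kronecker_self hA₁ Matrix.conjTranspose_one)
    (kronecker_mul_self_eq_one hA₁' (one_mul 1)) hV hA (1 : Matrix (Fin 3) (Fin 3) ℂ) (by
      ext i j
      fin_cases i <;> fin_cases j <;> simp [Matrix.mul_apply, Fin.sum_univ_three])
  have eB := mul_mul_eq_of_compression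
    (conjTranspose_kronecker_self Matrix.conjTranspose_one hB₁)
    (kronecker_mul_self_eq_one (one_mul 1) hB₁') hV hB (1 : Matrix (Fin 3) (Fin 3) ℂ) (by
      ext i j
      fin_cases i <;> fin_cases j <;> simp [Matrix.mul_apply, Fin.sum_univ_three])
  have e₂ := mul_mul_eq_of_compression (conjTranspose_kronecker_self hA₂ hB₂)
    (kronecker_mul_self_eq_one hA₂' hB₂') hV h₂ (!![0; 0; 1] : Matrix (Fin 3) (Fin 1) ℂ) (by
      ext i j
      fin_cases i <;> fin_cases j <;>
        simp [Matrix.mul_apply, Fin.sum_univ_three, hs]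
      norm_num)
  rw [Matrix.mul_one, Matrix.mul_one] at e₃ eA eB
  have f₃ := congrArg (coeffMatrix · 0) e₃
  have fA₀ := congrArg (coeffMatrix · 0) eA
  have fA₁ := congrArg (coeffMatrix · 1) eA
  have fB₀ := congrArg (coeffMatrix · 0) eB
  have fB₁ := congrArg (coeffMatrix · 1) eB
  have f₂ := congrArg (coeffMatrix · 0) e₂
  simp only [Matrix.mul_assoc (A₂ ⊗ₖ B₂)] at f₂
  simp only [coeffMatrix_kronecker_mul, Matrix.transpose_one, Matrix.mul_one, Matrix.one_mul]
    at f₃ fA₀ fA₁ fB₀ fB₁ f₂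
  set X := coeffMatrix V 0 with hX
  set Y := coeffMatrix V 1 with hY
  set Z := coeffMatrix V 2 with hZ
  replace f₃ : A₃ * X * B₃ᵀ = Z := by
    rw [f₃]; ext a b; simp [hZ, coeffMatrix, Matrix.mul_apply, Fin.sum_univ_three]
  replace fA₀ : A₁ * X = X := by
    rw [fA₀]; ext a b; simp [hX, coeffMatrix, Matrix.mul_apply, Fin.sum_univ_three]
  replace fA₁ : A₁ * Y = -Y := by
    rw [fA₁]; ext a b; simp [hY, coeffMatrix, Matrix.mul_apply, Fin.sum_univ_three]
  replace fB₀ : X * B₁ᵀ = X := by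
    rw [fB₀]; ext a b; simp [hX, coeffMatrix, Matrix.mul_apply, Fin.sum_univ_three]
  replace fB₁ : Y * B₁ᵀ = -Y := by
    rw [fB₁]; ext a b; simp [hY, coeffMatrix, Matrix.mul_apply, Fin.sum_univ_three]
  have hZ' : coeffMatrix (V * (!![0; 0; 1] : Matrix (Fin 3) (Fin 1) ℂ)) 0 = Z := by
    ext a b; simp [hZ, coeffMatrix, Matrix.mul_apply, Fin.sum_univ_three]
  replace f₂ : A₂ * Z * B₂ᵀ = invSqrt2 • (X + Y) := by
    rw [← hZ', f₂]; ext a b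
    simp [hX, hY, coeffMatrix, Matrix.mul_apply, Fin.sum_univ_three]
    ring
  have hr : (X + Y).rank = X.rank := by
    rw [← rank_mul_mul_transpose_of_involutive hA₃' hB₃' X, f₃,
      ← rank_mul_mul_transpose_of_involutive hA₂' hB₂' Z, f₂,
      Matrix.rank_smul_of_mem_nonZeroDivisors _ (mem_nonZeroDivisors_of_ne_zero hs0)]
  have hY0 := eq_zero_of_rank_add_eq fA₀ fA₁ fB₀ fB₁ hr
  have hcol : ∀ p, V p 1 = 0 := fun p => congrFun (congrFun hY0 p.1) p.2
  have h11 := congrFun (congrFun hV 1) 1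
  simp [Matrix.mul_apply, hcol] at h11
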